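/- arXiv:1111.3620 — 2 statements merged into one kernel-verified Lean document; each statement's English description precedes it below -/
import Mathlib

section
/- Let X be a finite set and 𝒰 a finite family of subsets covering X which is connected: for all C, C' ∈ 𝒰 there is a finite sequence C_0 = C, C_1, …, C_n, C_{n+1} = C' of members of 𝒰 with C_i ∩ C_{i+1} ≠ ∅ for all 0 ≤ i ≤ n. Suppose c assigns to each C ∈ 𝒰 a function c_C : X → ℤ with c_C(m) = 0 for m ∉ C, satisfying the compatibility equations of a ℤ-linear family for the Kochen–Specker support: for all C, C' ∈ 𝒰 with C ∩ C' ≠ ∅, (i) c_C(m) = c_{C'}(m) for every m ∈ C ∩ C', and (ii) Σ_{m ∈ C \ C'} c_C(m) = Σ_{m ∈ C' \ C} c_{C'}(m). Suppose moreover there exist C_0 ∈ 𝒰 and m_0 ∈ C_0 such that c_{C_0}(m_0) = 1 and c_{C_0}(m) = 0 for all m ∈ C_0 with m ≠ m_0 (i.e., the family extends a section in the support, so the cohomological obstruction vanishes for that section). Then gcd{d_m : m ∈ X} divides |𝒰|, where d_m = |{C ∈ 𝒰 : m ∈ C}|. -/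
/-- Let `X` be a finite set and `𝒰` a connected finite cover of `X`. If `c` is a family of
`ℤ`-linear coefficients for the Kochen–Specker support satisfying the compatibility equations
(i) and (ii), and the family extends a section in the support (so the cohomological obstruction
vanishes for that section), then `gcd {d_m : m ∈ X}` divides `|𝒰|`, where `d_m` is the number
of contexts containing `m`. -/
theorem ks_obstruction_vanishes_implies_gcd_condition
    {X : Type*} [Fintype X] [DecidableEq X]
    (𝒰 : Finset (Finset X))
    (hcov : ∀ x : X, ∃ C ∈ 𝒰, x ∈ C)
    (hconn : ∀ C ∈ 𝒰, ∀ C' ∈ 𝒰, ∃ (n : ℕ) (f : Fin (n + 2) → Finset X),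
      (∀ i, f i ∈ 𝒰) ∧ f 0 = C ∧ f (Fin.last (n + 1)) = C' ∧
      ∀ i : Fin (n + 1), (f i.castSucc ∩ f i.succ).Nonempty)
    (c : Finset X → X → ℤ)
    (hc0 : ∀ C ∈ 𝒰, ∀ m ∉ C, c C m = 0)
    (hcompat : ∀ C ∈ 𝒰, ∀ C' ∈ 𝒰, (C ∩ C').Nonempty →
      (∀ m ∈ C ∩ C', c C m = c C' m) ∧
      (∑ m ∈ C \ C', c C m) = (∑ m ∈ C' \ C, c C' m))
    (hsec : ∃ C₀ ∈ 𝒰, ∃ m₀ ∈ C₀, c C₀ m₀ = 1 ∧ ∀ m ∈ C₀, m ≠ m₀ → c C₀ m = 0) :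
    Finset.univ.gcd (fun m : X => (𝒰.filter (fun C => m ∈ C)).card) ∣ 𝒰.card := by
  obtain ⟨C₀, hC₀, m₀, hm₀, hone, hzero⟩ := hsec
  have hstep : ∀ C ∈ 𝒰, ∀ C' ∈ 𝒰, (C ∩ C').Nonempty → ∑ m ∈ C, c C m = ∑ m ∈ C', c C' m := by
    intro C hC C' hC' hne
    obtain ⟨h₁, h₂⟩ := hcompat C hC C' hC' hne
    rw [← Finset.sum_inter_add_sum_sdiff C C', ← Finset.sum_inter_add_sum_sdiff C' C, h₂,
      Finset.inter_comm C' C, Finset.sum_congr rfl h₁]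
  have hsum₀ : ∑ m ∈ C₀, c C₀ m = 1 := by
    rw [Finset.sum_eq_single_of_mem m₀ hm₀ hzero, hone]
  have hsum : ∀ C ∈ 𝒰, ∑ m ∈ C, c C m = 1 := by
    intro C hC
    obtain ⟨n, f, hf, hf0, hfl, hadj⟩ := hconn C₀ hC₀ C hC
    have hchain : ∀ i, ∑ m ∈ f i, c (f i) m = 1 := by
      intro i
      induction i using Fin.induction with
      | zero => rw [hf0, hsum₀]
      | succ i ih => rw [← hstep _ (hf _) _ (hf _) (hadj i), ih]
    rw [← hfl]
    exact hchain _
  choose D hD hmD using hcov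
  have hglobal : ∀ C ∈ 𝒰, ∀ m ∈ C, c C m = c (D m) m := fun C hC m hm ↦
    have hmem : m ∈ C ∩ D m := Finset.mem_inter.2 ⟨hm, hmD m⟩
    (hcompat C hC (D m) (hD m) ⟨m, hmem⟩).1 m hmem
  have hcount : (𝒰.card : ℤ) =
      ∑ m : X, ((𝒰.filter (fun C => m ∈ C)).card : ℤ) * c (D m) m := by
    calc (𝒰.card : ℤ) = ∑ C ∈ 𝒰, ∑ m ∈ C, c (D m) m := by
          rw [Finset.card_eq_sum_ones, Nat.cast_sum]
          refine Finset.sum_congr rfl fun C hC ↦ ?_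
          rw [← Finset.sum_congr rfl (hglobal C hC), hsum C hC, Nat.cast_one]
      _ = ∑ m : X, ∑ C ∈ 𝒰.filter (fun C => m ∈ C), c (D m) m :=
          Finset.sum_comm' (by simp)
      _ = _ := by simp
  rw [← Int.natCast_dvd_natCast, hcount]
  exact Finset.dvd_sum fun m hm ↦
    Dvd.dvd.mul_right (Int.natCast_dvd_natCast.2 (Finset.gcd_dvd hm)) _
end

section
/- Consider elements a, b, c, d, e, f, g, h, i, j, k, l, m, n, o, p of ℤ/2ℤ satisfying the twelve equations: a+b = e+f, c+d = g+h, a+c = i+k, b+d = j+l, a+d = n+o, b+c = m+p, f+g = j+k, e+h = i+l, e+g = m+o, f+h = n+p, i+j = m+n, k+l = o+p. Group the variables into four rows: (a,b,c,d), (e,f,g,h), (i,j,k,l), (m,n,o,p). Then there is no solution in which, for some row, one designated variable of that row equals 1 and the other three variables of that row equal 0. (This shows that the cohomological obstruction is non-vanishing, over ℤ/2ℤ and hence over ℤ, for every section in the support of the GHZ model, witnessing its strong contextuality.) -/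
/-- `oneHot w x y z` says that the designated variable `w` of the row `(w, x, y, z)` equals `1`
and the other three equal `0`, for some choice of designated variable among the four. -/
def oneHotRow (w x y z : ZMod 2) : Prop :=
  (w = 1 ∧ x = 0 ∧ y = 0 ∧ z = 0) ∨ (x = 1 ∧ w = 0 ∧ y = 0 ∧ z = 0) ∨
  (y = 1 ∧ w = 0 ∧ x = 0 ∧ z = 0) ∨ (z = 1 ∧ w = 0 ∧ x = 0 ∧ y = 0)

theorem oneHotRow.sum_eq_one {w x y z : ZMod 2} (hw : oneHotRow w x y z) :
    w + x + y + z = 1 := by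
  rcases hw with ⟨rfl, rfl, rfl, rfl⟩ | ⟨rfl, rfl, rfl, rfl⟩ | ⟨rfl, rfl, rfl, rfl⟩ |
    ⟨rfl, rfl, rfl, rfl⟩ <;> simp

/-- If elements `a, …, p` of `ℤ/2ℤ` satisfy the twelve GHZ compatibility equations, then no row
`(a,b,c,d)`, `(e,f,g,h)`, `(i,j,k,l)`, `(m,n,o,p)` has one designated variable equal to `1` and
the other three equal to `0`. (This is the non-vanishing, over `ℤ/2ℤ` and hence over `ℤ`, of
the cohomological obstruction for every section in the support of the GHZ model, witnessing its
strong contextuality.) -/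
theorem ghz_obstruction_nonvanishing (a b c d e f g h i j k l m n o p : ZMod 2)
    (h1 : a + b = e + f) (h2 : c + d = g + h)
    (h3 : a + c = i + k) (h4 : b + d = j + l)
    (h5 : a + d = n + o) (h6 : b + c = m + p)
    (h7 : f + g = j + k) (h8 : e + h = i + l)
    (h9 : e + g = m + o) (h10 : f + h = n + p)
    (h11 : i + j = m + n) (h12 : k + l = o + p) :
    ¬(oneHotRow a b c d ∨ oneHotRow e f g h ∨ oneHotRow i j k l ∨ oneHotRow m n o p) := by
  have two : (2 : ZMod 2) = 0 := rfl
  have habcd : a + b + c + d = 0 := by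
    linear_combination h1 + h3 + h5 + h7 + h9 + h11 - (a + g - k - n - o - m) * two
  have hefgh : e + f + g + h = 0 := by linear_combination habcd - h1 - h2
  have hijkl : i + j + k + l = 0 := by linear_combination habcd - h3 - h4
  have hmnop : m + n + o + p = 0 := by linear_combination habcd - h5 - h6
  rintro (H | H | H | H)
  · exact zero_ne_one (habcd.symm.trans H.sum_eq_one)
  · exact zero_ne_one (hefgh.symm.trans H.sum_eq_one)
  · exact zero_ne_one (hijkl.symm.trans H.sum_eq_one)
  · exact zero_ne_one (hmnop.symm.trans H.sum_eq_one)
end
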